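/- Let X_1,…,X_n be random variables whose joint distribution is absolutely continuous with respect to the product of the distributions determined by the cdfs F_1,…,F_n. Then X_1,…,X_n have one-dimensional cdfs F_1,…,F_n if and only if there exists a sum of U-statistics U_n(ξ_1,…,ξ_n) = Σ_{c=2}^{n} Σ_{1≤i_1<⋯<i_c≤n} g_{i_1,…,i_c}(ξ_{i_1},…,ξ_{i_c}) with kernels satisfying conditions A1–A3, such that for every Borel measurable function f : ℝ^n → ℝ for which the expectations exist, E f(X_1,…,X_n) = E [ f(ξ_1,…,ξ_n) (1 + U_n(ξ_1,…,ξ_n)) ]. -/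

import Mathlib

open MeasureTheory Finset

/-- A function `g` on `ℝⁿ` depends only on the coordinates in `S`
(i.e., it is really a function of the variables `x_i`, `i ∈ S`). -/
def DependsOnlyOn {n : ℕ} (S : Finset (Fin n)) (g : (Fin n → ℝ) → ℝ) : Prop :=
  ∀ x y : Fin n → ℝ, (∀ i ∈ S, x i = y i) → g x = g y

/-- The sum of U-statistics `U_n(x) = Σ_{c=2}^n Σ_{i_1<⋯<i_c} g_{i_1,…,i_c}(x_{i_1},…,x_{i_c})`,
where the kernel for the index set `S = {i_1,…,i_c}` is `g S`. -/
noncomputable def Usum {n : ℕ} (g : Finset (Fin n) → (Fin n → ℝ) → ℝ) (x : Fin n → ℝ) : ℝ :=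
  ∑ S ∈ Finset.univ.filter (fun S : Finset (Fin n) => 2 ≤ S.card), g S x

/-- Conditions A1 (integrability), A2 (degeneracy: zero mean in each argument, a.s. in
the remaining arguments) and A3 (positive definiteness: `U_n ≥ -1` a.s.) for a family of
Borel kernels `g_{i_1,…,i_c}`, with respect to independent random variables `ξ_1,…,ξ_n`
with distributions `μ_1,…,μ_n` (whose joint law is `Measure.pi μ`). -/
def IsKernelSystem {n : ℕ} (μ : Fin n → Measure ℝ) (g : Finset (Fin n) → (Fin n → ℝ) → ℝ) :
    Prop :=
  (∀ S : Finset (Fin n), 2 ≤ S.card →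
      Measurable (g S) ∧ DependsOnlyOn S (g S) ∧
      Integrable (g S) (Measure.pi μ) ∧
      ∀ k ∈ S, ∀ᵐ x ∂Measure.pi μ, ∫ t, g S (Function.update x k t) ∂μ k = 0) ∧
  (∀ᵐ x ∂Measure.pi μ, -1 ≤ Usum g x)

/-- The alternating sum `∑_{T ⊆ S} (-1)^{|S| + |T|} f T`, i.e. the Möbius transform of `f` on the
lattice of finite sets. -/
noncomputable def moebiusSum {ι : Type*} (f : Finset ι → ℝ) (S : Finset ι) : ℝ :=
  ∑ T ∈ S.powerset, (-1) ^ (S.card + T.card) * f T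

theorem moebiusSum_insert {ι : Type*} [DecidableEq ι] (f : Finset ι → ℝ) {k : ι} {S : Finset ι}
    (hk : k ∉ S) :
    moebiusSum f (insert k S) = moebiusSum (fun T => f (insert k T)) S - moebiusSum f S := by
  unfold moebiusSum
  rw [Finset.sum_powerset_insert hk, add_comm, sub_eq_add_neg, ← Finset.sum_neg_distrib]
  congr 1
  · refine Finset.sum_congr rfl fun T hT => ?_
    have hkT : k ∉ T := fun h => hk (Finset.mem_powerset.1 hT h)
    rw [Finset.card_insert_of_notMem hk, Finset.card_insert_of_notMem hkT]
    ring
  · refine Finset.sum_congr rfl fun T _ => ?_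
    rw [Finset.card_insert_of_notMem hk]
    ring

theorem sum_powerset_moebiusSum {ι : Type*} [DecidableEq ι] (f : Finset ι → ℝ) (U : Finset ι) :
    ∑ S ∈ U.powerset, moebiusSum f S = f U := by
  induction U using Finset.induction_on generalizing f with
  | empty => simp [moebiusSum]
  | insert k U hk ih =>
    rw [Finset.sum_powerset_insert hk, ← Finset.sum_add_distrib, ← ih fun T => f (insert k T)]
    refine Finset.sum_congr rfl fun S hS => ?_
    rw [moebiusSum_insert f fun h => hk (Finset.mem_powerset.1 hS h)]
    ring

section Resampling

variable {n : ℕ} (μ : Fin n → Measure ℝ) {h : (Fin n → ℝ) → ℝ}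

/-- The conditional expectation of `h` given the coordinates in `T`, under the product law. -/
noncomputable def marginal (h : (Fin n → ℝ) → ℝ) (T : Finset (Fin n)) (x : Fin n → ℝ) : ℝ :=
  ∫ y, h (T.piecewise x y) ∂Measure.pi μ

theorem dependsOnlyOn_marginal (T : Finset (Fin n)) : DependsOnlyOn T (marginal μ h T) := by
  intro x y hxy
  have hpw : ∀ z, T.piecewise x z = T.piecewise y z := fun z =>
    T.piecewise_congr hxy fun _ _ => rfl
  simp only [marginal, hpw]

theorem marginal_empty (x : Fin n → ℝ) : marginal μ h ∅ x = ∫ y, h y ∂Measure.pi μ := by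
  simp [marginal]

theorem marginal_update_of_notMem {k : Fin n} {T : Finset (Fin n)} (hk : k ∉ T)
    (x : Fin n → ℝ) (t : ℝ) : marginal μ h T (Function.update x k t) = marginal μ h T x :=
  dependsOnlyOn_marginal μ T _ _ fun _ hi =>
    Function.update_of_ne (ne_of_mem_of_not_mem hi hk) _ _

theorem measurable_piecewise_prod (T : Finset (Fin n)) :
    Measurable fun p : (Fin n → ℝ) × (Fin n → ℝ) => T.piecewise p.1 p.2 := by
  refine measurable_pi_iff.2 fun i => ?_
  by_cases hi : i ∈ T
  · simp only [Finset.piecewise_eq_of_mem _ _ _ hi]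
    fun_prop
  · simp only [Finset.piecewise_eq_of_notMem _ _ _ hi]
    fun_prop

theorem measurable_update_prod (k : Fin n) :
    Measurable fun p : (Fin n → ℝ) × ℝ => Function.update p.1 k p.2 := by
  refine measurable_pi_iff.2 fun i => ?_
  by_cases hi : i = k
  · subst hi
    simp only [Function.update_self]
    fun_prop
  · simp only [Function.update_of_ne hi]
    fun_prop

variable [∀ i, IsProbabilityMeasure (μ i)]

/-- Replacing the coordinates outside `T` by an independent copy preserves a product law. -/
theorem measurePreserving_piecewise (T : Finset (Fin n)) :
    MeasurePreserving (fun p : (Fin n → ℝ) × (Fin n → ℝ) => T.piecewise p.1 p.2)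
      ((Measure.pi μ).prod (Measure.pi μ)) (Measure.pi μ) := by
  refine ⟨measurable_piecewise_prod T, (Measure.pi_eq fun s hs => ?_).symm⟩
  have hpre : (fun p : (Fin n → ℝ) × (Fin n → ℝ) => T.piecewise p.1 p.2) ⁻¹' Set.univ.pi s =
      (Set.univ.pi fun i => if i ∈ T then s i else Set.univ) ×ˢ
        (Set.univ.pi fun i => if i ∈ T then Set.univ else s i) := by
    ext p
    simp only [Set.mem_preimage, Set.mem_pi, Set.mem_univ, true_imp_iff, Set.mem_prod,
      ← forall_and]
    refine forall_congr' fun i => ?_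
    by_cases hi : i ∈ T <;> simp [hi]
  rw [Measure.map_apply (measurable_piecewise_prod T) (MeasurableSet.univ_pi hs), hpre,
    Measure.prod_prod, Measure.pi_pi, Measure.pi_pi, ← Finset.prod_mul_distrib]
  refine Finset.prod_congr rfl fun i _ => ?_
  by_cases hi : i ∈ T <;> simp [hi]

/-- Replacing one coordinate by an independent copy preserves a product law. -/
theorem measurePreserving_update (k : Fin n) :
    MeasurePreserving (fun p : (Fin n → ℝ) × ℝ => Function.update p.1 k p.2)
      ((Measure.pi μ).prod (μ k)) (Measure.pi μ) := by
  refine ⟨measurable_update_prod k, (Measure.pi_eq fun s hs => ?_).symm⟩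
  have hpre : (fun p : (Fin n → ℝ) × ℝ => Function.update p.1 k p.2) ⁻¹' Set.univ.pi s =
      (Set.univ.pi (Function.update s k Set.univ)) ×ˢ s k := by
    ext p
    simp only [Set.mem_preimage, Set.mem_pi, Set.mem_univ, true_imp_iff, Set.mem_prod]
    constructor
    · refine fun h => ⟨fun i => ?_, by simpa using h k⟩
      by_cases hi : i = k
      · subst hi; simp
      · simpa [hi] using h i
    · rintro ⟨h, hk⟩ i
      by_cases hi : i = k
      · subst hi; simpa using hk
      · simpa [hi] using h i
  rw [Measure.map_apply (measurable_update_prod k) (MeasurableSet.univ_pi hs), hpre,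
    Measure.prod_prod, Measure.pi_pi, ← Finset.mul_prod_erase _ _ (Finset.mem_univ k),
    ← Finset.mul_prod_erase _ (fun i => μ i (s i)) (Finset.mem_univ k), Function.update_self,
    measure_univ, one_mul, mul_comm]
  congr 1
  refine Finset.prod_congr rfl fun i hi => ?_
  rw [Function.update_of_ne (Finset.ne_of_mem_erase hi)]

theorem integrable_update {f : (Fin n → ℝ) → ℝ} (hf : Integrable f (Measure.pi μ)) (k : Fin n) :
    Integrable (fun p : (Fin n → ℝ) × ℝ => f (Function.update p.1 k p.2))
      ((Measure.pi μ).prod (μ k)) :=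
  (measurePreserving_update μ k).integrable_comp_of_integrable hf

theorem integral_prod_update {f : (Fin n → ℝ) → ℝ} (hf : Integrable f (Measure.pi μ))
    (k : Fin n) :
    ∫ p, f (Function.update p.1 k p.2) ∂(Measure.pi μ).prod (μ k) = ∫ x, f x ∂Measure.pi μ := by
  have hmp := measurePreserving_update μ k
  conv_rhs => rw [← hmp.map_eq]
  exact (integral_map hmp.aemeasurable (by rw [hmp.map_eq]; exact hf.aestronglyMeasurable)).symm

theorem measurable_marginal (hh : Measurable h) (T : Finset (Fin n)) :
    Measurable (marginal μ h T) := by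
  have hm : StronglyMeasurable fun p : (Fin n → ℝ) × (Fin n → ℝ) => h (T.piecewise p.1 p.2) :=
    (hh.comp (measurable_piecewise_prod T)).stronglyMeasurable
  exact (hm.integral_prod_right' (ν := Measure.pi μ)).measurable

theorem integrable_marginal (hi : Integrable h (Measure.pi μ)) (T : Finset (Fin n)) :
    Integrable (marginal μ h T) (Measure.pi μ) :=
  ((measurePreserving_piecewise μ T).integrable_comp_of_integrable hi).integral_prod_left

theorem marginal_univ (x : Fin n → ℝ) : marginal μ h Finset.univ x = h x := by
  simp [marginal]

theorem ae_integral_marginal_insert (hi : Integrable h (Measure.pi μ)) {k : Fin n}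
    {T : Finset (Fin n)} (hk : k ∉ T) :
    ∀ᵐ x ∂Measure.pi μ,
      Integrable (fun t => marginal μ h (insert k T) (Function.update x k t)) (μ k) ∧
        ∫ t, marginal μ h (insert k T) (Function.update x k t) ∂μ k = marginal μ h T x := by
  have hpw : ∀ (x y : Fin n → ℝ) (t : ℝ), (insert k T).piecewise (Function.update x k t) y =
      T.piecewise x (Function.update y k t) := by
    intro x y t
    ext i
    by_cases hik : i = k
    · subst hik; simp [hk]
    · by_cases hiT : i ∈ T <;> simp [hik, hiT]
  filter_upwards [((measurePreserving_piecewise μ T).integrable_comp_of_integrable hi).prod_right_ae]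
    with x hx
  have hx' : Integrable (fun y => h (T.piecewise x y)) (Measure.pi μ) := hx
  have h_int := integrable_update μ hx' k
  simp only [marginal, hpw]
  exact ⟨h_int.integral_prod_right, by
    rw [← integral_prod_update μ hx' k, integral_prod_symm _ h_int]⟩

theorem ae_integral_moebiusSum_marginal (hi : Integrable h (Measure.pi μ)) {k : Fin n}
    {S : Finset (Fin n)} (hk : k ∈ S) :
    ∀ᵐ x ∂Measure.pi μ,
      ∫ t, moebiusSum (fun T => marginal μ h T (Function.update x k t)) S ∂μ k = 0 := by
  obtain ⟨S, hkS, rfl⟩ : ∃ S', k ∉ S' ∧ insert k S' = S :=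
    ⟨S.erase k, Finset.notMem_erase k S, Finset.insert_erase hk⟩
  have hall : ∀ᵐ x ∂Measure.pi μ, ∀ T ∈ S.powerset,
      Integrable (fun t => marginal μ h (insert k T) (Function.update x k t)) (μ k) ∧
        ∫ t, marginal μ h (insert k T) (Function.update x k t) ∂μ k = marginal μ h T x :=
    (Finset.eventually_all _).2 fun T hT => ae_integral_marginal_insert μ hi
      fun hkT => hkS (Finset.mem_powerset.1 hT hkT)
  filter_upwards [hall] with x hx
  have hconst : ∀ t, moebiusSum (fun T => marginal μ h T (Function.update x k t)) S =
      moebiusSum (fun T => marginal μ h T x) S := fun t =>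
    Finset.sum_congr rfl fun T hT => by
      simp only [marginal_update_of_notMem μ fun hkT => hkS (Finset.mem_powerset.1 hT hkT)]
  simp only [moebiusSum_insert _ hkS, hconst]
  have hterm : ∀ T ∈ S.powerset, Integrable (fun t => (-1 : ℝ) ^ (S.card + T.card) *
      marginal μ h (insert k T) (Function.update x k t)) (μ k) :=
    fun T hT => (hx T hT).1.const_mul _
  have hsum : ∫ t, moebiusSum (fun T => marginal μ h (insert k T) (Function.update x k t)) S ∂μ k =
      moebiusSum (fun T => marginal μ h T x) S := by
    unfold moebiusSum
    rw [integral_finsetSum _ hterm]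
    refine Finset.sum_congr rfl fun T hT => ?_
    rw [integral_const_mul, (hx T hT).2]
  have h_int : Integrable
      (fun t => moebiusSum (fun T => marginal μ h (insert k T) (Function.update x k t)) S) (μ k) :=
    integrable_finsetSum _ hterm
  rw [integral_sub h_int (integrable_const _), hsum]
  simp

theorem ae_marginal_singleton_eq_one (hi : Integrable h (Measure.pi μ)) (i : Fin n)
    (hmarg : ∀ B : Set ℝ, MeasurableSet B →
      ∫ x in (fun x : Fin n → ℝ => x i) ⁻¹' B, h x ∂Measure.pi μ = (μ i).real B) :
    ∀ᵐ x ∂Measure.pi μ, marginal μ h {i} x = 1 := by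
  have h_int := integrable_update μ hi i
  have hone : (fun t => ∫ y, h (Function.update y i t) ∂Measure.pi μ) =ᵐ[μ i] fun _ => (1 : ℝ) := by
    refine Integrable.ae_eq_of_forall_setIntegral_eq _ _ h_int.integral_prod_right
      (integrable_const _) fun B hB _ => ?_
    have hBi : MeasurableSet ((fun x : Fin n → ℝ => x i) ⁻¹' B) := measurable_pi_apply i hB
    rw [setIntegral_const, smul_eq_mul, mul_one, ← hmarg B hB, ← integral_indicator hBi,
      ← integral_indicator hB]
    have hind := hi.indicator hBi
    rw [← integral_prod_update μ hind i, integral_prod_symm _ (integrable_update μ hind i)]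
    refine integral_congr_ae (Filter.Eventually.of_forall fun t => ?_)
    by_cases ht : t ∈ B <;> simp [Set.indicator, ht]
  filter_upwards [(measurePreserving_eval μ i).quasiMeasurePreserving.ae hone] with x hx
  simpa [marginal, Finset.piecewise_singleton] using hx

/-- The Hoeffding decomposition of a density whose one-dimensional marginals are trivial has no
terms of order one. -/
theorem ae_one_add_Usum_moebiusSum_marginal (hone : ∫ x, h x ∂Measure.pi μ = 1)
    (hmarg : ∀ i, ∀ᵐ x ∂Measure.pi μ, marginal μ h {i} x = 1) :
    ∀ᵐ x ∂Measure.pi μ,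
      1 + Usum (fun S x => moebiusSum (fun T => marginal μ h T x) S) x = h x := by
  filter_upwards [ae_all_iff.2 hmarg] with x hx
  set G := moebiusSum (fun T => marginal μ h T x) with hG
  have htotal : ∑ S, G S = h x := by
    rw [← Finset.powerset_univ, hG, sum_powerset_moebiusSum, marginal_univ]
  have hlow : ∑ S with ¬ 2 ≤ S.card, G S = G ∅ := by
    refine Finset.sum_eq_single_of_mem _ (by simp) fun S hS hne => ?_
    have hcard : S.card = 1 := by
      have := Finset.card_pos.2 (Finset.nonempty_iff_ne_empty.2 hne)
      have := (Finset.mem_filter.1 hS).2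
      omega
    obtain ⟨i, rfl⟩ := Finset.card_eq_one.1 hcard
    have hins := moebiusSum_insert (fun T => marginal μ h T x) (Finset.notMem_empty i)
    simp only [insert_empty_eq] at hins
    rw [hG, hins]
    simp [moebiusSum, hx i, marginal_empty, hone]
  have hempty : G ∅ = 1 := by simp [hG, moebiusSum, marginal_empty, hone]
  rw [← htotal, ← Finset.sum_filter_add_sum_filter_not _ (fun S : Finset (Fin n) => 2 ≤ S.card),
    hlow, hempty, add_comm]
  rfl

theorem isKernelSystem_moebiusSum_marginal (hh : Measurable h) (hi : Integrable h (Measure.pi μ))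
    (hnonneg : ∀ x, 0 ≤ h x)
    (hU : ∀ᵐ x ∂Measure.pi μ,
      1 + Usum (fun S x => moebiusSum (fun T => marginal μ h T x) S) x = h x) :
    IsKernelSystem μ fun S x => moebiusSum (fun T => marginal μ h T x) S := by
  refine ⟨fun S _ => ⟨?_, fun x y hxy => ?_, ?_, fun k hk => ?_⟩, ?_⟩
  · exact Finset.measurable_fun_sum _ fun T _ => (measurable_marginal μ hh T).const_mul _
  · refine Finset.sum_congr rfl fun T hT => ?_
    simp only [dependsOnlyOn_marginal μ T x y fun i hiT => hxy i (Finset.mem_powerset.1 hT hiT)]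
  · exact integrable_finsetSum _ fun T _ => (integrable_marginal μ hi T).const_mul _
  · exact ae_integral_moebiusSum_marginal μ hi hk
  · filter_upwards [hU] with x hx
    linarith [hnonneg x]

theorem setIntegral_kernel_eq_zero {g : (Fin n → ℝ) → ℝ} {k i : Fin n} (hki : k ≠ i)
    (hg : Integrable g (Measure.pi μ))
    (hdeg : ∀ᵐ x ∂Measure.pi μ, ∫ t, g (Function.update x k t) ∂μ k = 0)
    {B : Set ℝ} (hB : MeasurableSet B) :
    ∫ x in (fun x : Fin n → ℝ => x i) ⁻¹' B, g x ∂Measure.pi μ = 0 := by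
  have hBi : MeasurableSet ((fun x : Fin n → ℝ => x i) ⁻¹' B) := measurable_pi_apply i hB
  rw [← integral_indicator hBi, ← integral_prod_update μ (hg.indicator hBi) k,
    integral_prod _ (integrable_update μ (hg.indicator hBi) k)]
  refine integral_eq_zero_of_ae ?_
  filter_upwards [hdeg] with x hx
  by_cases hxB : x i ∈ B
  · simpa [Set.indicator, Function.update_of_ne hki.symm, hxB] using hx
  · simp [Set.indicator, Function.update_of_ne hki.symm, hxB]

theorem IsKernelSystem.integrable_Usum {μ : Fin n → Measure ℝ}
    {g : Finset (Fin n) → (Fin n → ℝ) → ℝ} (hg : IsKernelSystem μ g) :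
    Integrable (Usum g) (Measure.pi μ) :=
  integrable_finsetSum _ fun S hS => (hg.1 S (Finset.mem_filter.1 hS).2).2.2.1

theorem IsKernelSystem.setIntegral_one_add_Usum {g : Finset (Fin n) → (Fin n → ℝ) → ℝ}
    (hg : IsKernelSystem μ g) (i : Fin n) {B : Set ℝ} (hB : MeasurableSet B) :
    ∫ x in (fun x : Fin n → ℝ => x i) ⁻¹' B, (1 + Usum g x) ∂Measure.pi μ = (μ i).real B := by
  have hzero : ∫ x in (fun x : Fin n → ℝ => x i) ⁻¹' B, Usum g x ∂Measure.pi μ = 0 := by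
    unfold Usum
    rw [integral_finsetSum _ fun S hS =>
      (hg.1 S (Finset.mem_filter.1 hS).2).2.2.1.integrableOn]
    refine Finset.sum_eq_zero fun S hS => ?_
    obtain ⟨-, -, h_int, hdeg⟩ := hg.1 S (Finset.mem_filter.1 hS).2
    obtain ⟨k, hk, hki⟩ := Finset.exists_mem_ne (Finset.mem_filter.1 hS).2 i
    exact setIntegral_kernel_eq_zero μ hki h_int (hdeg k hk) hB
  rw [integral_add (integrable_const _) hg.integrable_Usum.integrableOn, hzero, setIntegral_const,
    smul_eq_mul, mul_one, add_zero,
    (measurePreserving_eval μ i).measureReal_preimage hB.nullMeasurableSet]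

end Resampling

/-- Theorem 4.1: let `ν` be the joint law of `X₁,…,Xₙ`, absolutely continuous with respect to
the product `Measure.pi μ` of the distributions determined by the cdfs `F₁,…,Fₙ` (the law of
the independent variables `ξ₁,…,ξₙ`). Then the `X_i` have one-dimensional cdfs `F₁,…,Fₙ`
(i.e. marginals `μ_i`) if and only if there is a sum of U-statistics `U_n` with kernels
satisfying A1–A3 such that for every Borel `f` for which the expectations exist,
`E f(X₁,…,Xₙ) = E [f(ξ₁,…,ξₙ) (1 + U_n(ξ₁,…,ξₙ))]`. -/
theorem statement3 (n : ℕ) (μ : Fin n → Measure ℝ) [∀ i, IsProbabilityMeasure (μ i)]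
    (ν : Measure (Fin n → ℝ)) [IsProbabilityMeasure ν] (hac : ν ≪ Measure.pi μ) :
    (∀ i, ν.map (fun x => x i) = μ i) ↔
      ∃ g : Finset (Fin n) → (Fin n → ℝ) → ℝ, IsKernelSystem μ g ∧
        ∀ f : (Fin n → ℝ) → ℝ, Measurable f → Integrable f ν →
          Integrable (fun t => f t * (1 + Usum g t)) (Measure.pi μ) →
          ∫ x, f x ∂ν = ∫ t, f t * (1 + Usum g t) ∂Measure.pi μ := by
  constructor
  · intro hν
    set h : (Fin n → ℝ) → ℝ := fun x => (ν.rnDeriv (Measure.pi μ) x).toReal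
    have hh : Measurable h := (Measure.measurable_rnDeriv _ _).ennreal_toReal
    have hi : Integrable h (Measure.pi μ) := Measure.integrable_toReal_rnDeriv
    have hset : ∀ s, MeasurableSet s → ∫ x in s, h x ∂Measure.pi μ = ν.real s :=
      fun s _ => Measure.setIntegral_toReal_rnDeriv hac s
    have hone : ∫ x, h x ∂Measure.pi μ = 1 := by
      rw [← setIntegral_univ, hset _ MeasurableSet.univ, probReal_univ]
    have hmarg : ∀ i, ∀ᵐ x ∂Measure.pi μ, marginal μ h {i} x = 1 := fun i =>
      ae_marginal_singleton_eq_one μ hi i fun B hB => by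
        rw [hset _ (measurable_pi_apply i hB), ← hν i,
          map_measureReal_apply (measurable_pi_apply i) hB]
    have hU := ae_one_add_Usum_moebiusSum_marginal μ hone hmarg
    refine ⟨fun S x => moebiusSum (fun T => marginal μ h T x) S,
      isKernelSystem_moebiusSum_marginal μ hh hi (fun _ => ENNReal.toReal_nonneg) hU,
      fun f _ _ _ => ?_⟩
    rw [← integral_rnDeriv_smul hac]
    refine integral_congr_ae ?_
    filter_upwards [hU] with x hx
    rw [hx, smul_eq_mul, mul_comm]
  · rintro ⟨g, hg, hf⟩ i
    have : IsProbabilityMeasure (ν.map fun x => x i) :=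
      Measure.isProbabilityMeasure_map (measurable_pi_apply i).aemeasurable
    refine Measure.ext fun B hB => (measureReal_eq_measureReal_iff).1 ?_
    have hBi : MeasurableSet ((fun x : Fin n → ℝ => x i) ⁻¹' B) := measurable_pi_apply i hB
    set A := (fun x : Fin n → ℝ => x i) ⁻¹' B
    have hmul : (fun t => A.indicator (fun _ => (1 : ℝ)) t * (1 + Usum g t)) =
        A.indicator fun t => 1 + Usum g t := by
      ext t
      by_cases ht : t ∈ A <;> simp [ht]
    have hkey := hf (A.indicator fun _ => 1) (measurable_const.indicator hBi)
      ((integrable_const _).indicator hBi)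
      (by rw [hmul]; exact ((integrable_const _).add hg.integrable_Usum).indicator hBi)
    rw [hmul, integral_indicator hBi, integral_indicator hBi,
      hg.setIntegral_one_add_Usum μ i hB, setIntegral_const, smul_eq_mul, mul_one] at hkey
    rw [map_measureReal_apply (measurable_pi_apply i) hB, hkey]
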